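/- arXiv:quant-ph/0503072 — 9 statements merged into one kernel-verified Lean document; each statement's English description precedes it below -/
import Mathlib

section
/- Let δ, η ∈ (0,2]. Suppose ε_a, ε̃_a, ε_b : [0,T] → ℝ are continuous controls, ψ_a is the state with control ε_a and initial datum ψ₀, χ_a is the adjoint state solving i·χ_a'(t) = (H − ε̃_a(t)·μ)(χ_a(t)) with terminal condition χ_a(T) = O ψ_a(T), ψ_b is the state with control ε_b and initial datum ψ₀, and the update relations ε̃_a(t) = (1−η)·ε_a(t) − (η/α)·Im⟨χ_a(t), μ ψ_a(t)⟩ and ε_b(t) = (1−δ)·ε̃_a(t) − (δ/α)·Im⟨χ_a(t), μ ψ_b(t)⟩ hold for all t ∈ [0,T]. If O is self-adjoint and positive semi-definite, then J(ε_b) ≥ J(ε_a). -/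
open MeasureTheory Set Filter

theorem deriv_aux {E : Type*} [NormedAddCommGroup E] [InnerProductSpace ℂ E] [CompleteSpace E]
    (H μ : E →L[ℂ] E) (hH : IsSelfAdjoint H) (hμ : IsSelfAdjoint μ) (e f t : ℝ) (χ ψ : ℝ → E)
    (hχ : HasDerivAt χ ((-Complex.I) • (H - e • μ) (χ t)) t)
    (hψ : HasDerivAt ψ ((-Complex.I) • (H - f • μ) (ψ t)) t) :
    HasDerivAt (fun s => (inner ℂ (χ s) (ψ s) : ℂ).re)
      (-(f - e) * (inner ℂ (χ t) (μ (ψ t)) : ℂ).im) t := by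
  have h := hχ.inner ℂ hψ
  have h2 := Complex.reCLM.hasFDerivAt.comp_hasDerivAt t h
  have hHs : ∀ x y : E, inner ℂ (H x) y = inner ℂ x (H y) := fun x y => hH.isSymmetric x y
  have hms : ∀ x y : E, inner ℂ (μ x) y = inner ℂ x (μ y) := fun x y => hμ.isSymmetric x y
  refine h2.congr_deriv ?_
  have e1 : ∀ (r : ℝ) (x : E), r • x = (r : ℂ) • x := fun r x => (Complex.coe_smul r x).symm
  simp only [ContinuousLinearMap.sub_apply, ContinuousLinearMap.smul_apply, e1,
    inner_smul_left, inner_smul_right, inner_sub_left, inner_sub_right, hHs, hms,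
    Complex.reCLM_apply]
  simp
  ring

/-- Monotonicity of the Maday–Turinici scheme step (Theorem 1 of the paper):
if `O` is self-adjoint positive semi-definite and `δ, η ∈ (0,2]`, one step of the
scheme does not decrease the cost functional
`J(ε) = Re⟨ψ(T), O ψ(T)⟩ − α ∫₀ᵀ ε²`. -/
theorem monotonic_step
    {E : Type*} [NormedAddCommGroup E] [InnerProductSpace ℂ E] [CompleteSpace E]
    (H μ O : E →L[ℂ] E) (hH : IsSelfAdjoint H) (hμ : IsSelfAdjoint μ)
    (hO : IsSelfAdjoint O) (hOpos : ∀ x : E, 0 ≤ (inner ℂ x (O x) : ℂ).re)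
    (T : ℝ) (hT : 0 < T) (α : ℝ) (hα : 0 < α) (ψ₀ : E)
    (δ η : ℝ) (hδ : δ ∈ Set.Ioc (0:ℝ) 2) (hη : η ∈ Set.Ioc (0:ℝ) 2)
    (εa εta εb : ℝ → ℝ)
    (hεac : ContinuousOn εa (Set.Icc 0 T)) (hεtac : ContinuousOn εta (Set.Icc 0 T))
    (hεbc : ContinuousOn εb (Set.Icc 0 T))
    (ψa χa ψb : ℝ → E)
    (hψa : ∀ t ∈ Set.Icc (0:ℝ) T,
      HasDerivAt ψa ((-Complex.I) • (H - εa t • μ) (ψa t)) t)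
    (hψa0 : ψa 0 = ψ₀)
    (hχa : ∀ t ∈ Set.Icc (0:ℝ) T,
      HasDerivAt χa ((-Complex.I) • (H - εta t • μ) (χa t)) t)
    (hχaT : χa T = O (ψa T))
    (hψb : ∀ t ∈ Set.Icc (0:ℝ) T,
      HasDerivAt ψb ((-Complex.I) • (H - εb t • μ) (ψb t)) t)
    (hψb0 : ψb 0 = ψ₀)
    (hupd1 : ∀ t ∈ Set.Icc (0:ℝ) T,
      εta t = (1 - η) * εa t - (η / α) * (inner ℂ (χa t) (μ (ψa t)) : ℂ).im)
    (hupd2 : ∀ t ∈ Set.Icc (0:ℝ) T,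
      εb t = (1 - δ) * εta t - (δ / α) * (inner ℂ (χa t) (μ (ψb t)) : ℂ).im) :
    (inner ℂ (ψa T) (O (ψa T)) : ℂ).re - α * ∫ t in (0:ℝ)..T, (εa t) ^ 2
      ≤ (inner ℂ (ψb T) (O (ψb T)) : ℂ).re - α * ∫ t in (0:ℝ)..T, (εb t) ^ 2 := by
  have hsO : ∀ x y : E, inner ℂ (O x) y = inner ℂ x (O y) := fun x y => hO.isSymmetric x y
  obtain ⟨hδ0, hδ2⟩ := hδ
  obtain ⟨hη0, hη2⟩ := hη
  set D : ℝ → ℝ := fun t => α * ((εb t - εta t) * (εb t - (1 - δ) * εta t) / δ)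
    - α * ((εa t - εta t) * (εta t - (1 - η) * εa t) / η) with hD
  have hDc : ContinuousOn D (Set.Icc 0 T) := by
    rw [hD]; fun_prop
  have hu : Set.uIcc 0 T = Set.Icc 0 T := Set.uIcc_of_le hT.le
  have hder : ∀ t ∈ Set.uIcc 0 T, HasDerivAt
      (fun s => (inner ℂ (χa s) (ψb s) : ℂ).re - (inner ℂ (χa s) (ψa s) : ℂ).re) (D t) t := by
    intro t ht
    rw [hu] at ht
    refine ((deriv_aux H μ hH hμ _ _ t χa ψb (hχa t ht) (hψb t ht)).sub
      (deriv_aux H μ hH hμ _ _ t χa ψa (hχa t ht) (hψa t ht))).congr_deriv ?_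
    have h1 := hupd1 t ht
    have h2 := hupd2 t ht
    have h1' : (inner ℂ (χa t) (μ (ψa t)) : ℂ).im = α * ((1 - η) * εa t - εta t) / η := by
      rw [h1]; field_simp; ring
    have h2' : (inner ℂ (χa t) (μ (ψb t)) : ℂ).im = α * ((1 - δ) * εta t - εb t) / δ := by
      rw [h2]; field_simp; ring
    rw [h1', h2', hD]
    ring
  have hint := intervalIntegral.integral_eq_sub_of_hasDerivAt hder
    (hDc.intervalIntegrable_of_Icc hT.le)
  rw [hψa0, hψb0, sub_self, sub_zero, hχaT, hsO, hsO] at hint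
  have ia : IntervalIntegrable (fun t => α * (εa t) ^ 2) volume 0 T :=
    ContinuousOn.intervalIntegrable_of_Icc hT.le (by fun_prop)
  have ib : IntervalIntegrable (fun t => α * (εb t) ^ 2) volume 0 T :=
    ContinuousOn.intervalIntegrable_of_Icc hT.le (by fun_prop)
  have iD : IntervalIntegrable (fun t => 2 * D t) volume 0 T :=
    ContinuousOn.intervalIntegrable_of_Icc hT.le (by fun_prop)
  have hmono := intervalIntegral.integral_mono_on hT.le (ib.sub ia) iD (by
    intro t _
    have k1 : 0 ≤ 2 / δ - 1 := by rw [sub_nonneg, le_div_iff₀ hδ0]; linarith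
    have k2 : 0 ≤ 2 / η - 1 := by rw [sub_nonneg, le_div_iff₀ hη0]; linarith
    have k3 : 0 ≤ α * ((2 / δ - 1) * (εb t - εta t) ^ 2 + (2 / η - 1) * (εa t - εta t) ^ 2) := by
      positivity
    have k4 : 2 * D t - (α * (εb t) ^ 2 - α * (εa t) ^ 2) =
      α * ((2 / δ - 1) * (εb t - εta t) ^ 2 + (2 / η - 1) * (εa t - εta t) ^ 2) := by
      rw [hD]; field_simp; ring
    linarith)
  rw [intervalIntegral.integral_sub ib ia, intervalIntegral.integral_const_mul,
    intervalIntegral.integral_const_mul, intervalIntegral.integral_const_mul, hint] at hmono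
  have hp := hOpos (ψb T - ψa T)
  have hsw : (inner ℂ (ψb T) (O (ψa T)) : ℂ).re = (inner ℂ (ψa T) (O (ψb T)) : ℂ).re := by
    rw [← hsO, ← inner_conj_symm, Complex.conj_re]
  simp only [map_sub, inner_sub_left, inner_sub_right, Complex.sub_re] at hp
  linarith
end

section
/- Let E be a complex Hilbert space, μ a continuous linear operator on E with operator norm ‖μ‖, α > 0, R ≥ 0, δ ∈ [0,2), and M a real number with M ≥ max(1, δ/(2−δ))·(R·‖μ‖/α). Let ψ, χ : [0,T] → E with ‖ψ(t)‖ = 1 and ‖χ(t)‖ ≤ R for all t ∈ [0,T], and let ε̃ : [0,T] → ℝ satisfy |ε̃(t)| ≤ M for all t. If ε : [0,T] → ℝ is defined by ε(t) = (1−δ)·ε̃(t) − (δ/α)·Im⟨χ(t), μ ψ(t)⟩, then |ε(t)| ≤ M for all t ∈ [0,T]. -/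
open Set

/-- Induction step of the uniform bound on the controls (Theorem 2 of the paper):
if `‖ψ(t)‖ = 1`, `‖χ(t)‖ ≤ R`, `|ε̃(t)| ≤ M` and
`M ≥ max(1, δ/(2−δ))·R‖μ‖/α`, then the updated control
`ε(t) = (1−δ)ε̃(t) − (δ/α)·Im⟨χ(t), μψ(t)⟩` also satisfies `|ε(t)| ≤ M`. -/
theorem control_update_bound
    {E : Type*} [NormedAddCommGroup E] [InnerProductSpace ℂ E]
    (μ : E →L[ℂ] E) (T α R δ M : ℝ) (hT : 0 < T) (hα : 0 < α) (hR : 0 ≤ R)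
    (hδ : δ ∈ Set.Ico (0:ℝ) 2)
    (hM : max 1 (δ / (2 - δ)) * (R * ‖μ‖ / α) ≤ M)
    (ψ χ : ℝ → E)
    (hψ : ∀ t ∈ Set.Icc (0:ℝ) T, ‖ψ t‖ = 1)
    (hχ : ∀ t ∈ Set.Icc (0:ℝ) T, ‖χ t‖ ≤ R)
    (εt ε : ℝ → ℝ)
    (hεt : ∀ t ∈ Set.Icc (0:ℝ) T, |εt t| ≤ M)
    (hε : ∀ t ∈ Set.Icc (0:ℝ) T,
      ε t = (1 - δ) * εt t - (δ / α) * (inner ℂ (χ t) (μ (ψ t)) : ℂ).im) :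
    ∀ t ∈ Set.Icc (0:ℝ) T, |ε t| ≤ M := by
  intro t ht
  obtain ⟨h0, h2⟩ := hδ
  have h2' : 0 < 2 - δ := by linarith
  have hin : |(inner ℂ (χ t) (μ (ψ t)) : ℂ).im| ≤ R * ‖μ‖ := by
    refine (Complex.abs_im_le_norm _).trans ((norm_inner_le_norm _ _).trans ?_)
    have h1 : ‖μ (ψ t)‖ ≤ ‖μ‖ := by
      have h := μ.le_opNorm (ψ t)
      rwa [hψ t ht, mul_one] at h
    exact mul_le_mul (hχ t ht) h1 (norm_nonneg _) hR
  have hK0 : 0 ≤ R * ‖μ‖ / α := by positivity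
  have hy : |(inner ℂ (χ t) (μ (ψ t)) : ℂ).im / α| ≤ R * ‖μ‖ / α := by
    rw [abs_div, abs_of_pos hα]
    gcongr
  have e : ε t = (1 - δ) * εt t - δ * ((inner ℂ (χ t) (μ (ψ t)) : ℂ).im / α) := by
    rw [hε t ht]; ring
  have hx := hεt t ht
  generalize (inner ℂ (χ t) (μ (ψ t)) : ℂ).im / α = y at hy e
  generalize R * ‖μ‖ / α = K at hM hK0 hy
  have hK1 : K ≤ M := by
    have h := mul_le_mul_of_nonneg_right (le_max_left 1 (δ / (2 - δ))) hK0
    linarith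
  have hK2 : δ * K ≤ (2 - δ) * M := by
    have h := (mul_le_mul_of_nonneg_right (le_max_right 1 (δ / (2 - δ))) hK0).trans hM
    have h3 := mul_le_mul_of_nonneg_left h h2'.le
    have h4 : (2 - δ) * (δ / (2 - δ) * K) = δ * K := by field_simp
    linarith
  have h5 : |ε t| ≤ |1 - δ| * M + δ * K := by
    rw [e]
    refine (abs_sub _ _).trans ?_
    rw [abs_mul, abs_mul, abs_of_nonneg h0]
    gcongr
  refine h5.trans ?_
  rcases le_total δ 1 with h | h
  · rw [abs_of_nonneg (by linarith)]
    nlinarith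
  · rw [abs_of_nonpos (by linarith)]
    nlinarith
end

section
/- Let X be a Banach space, λ a real number with |λ| < 1, C ≥ 0, and (x_k)_{k∈ℕ}, (v_k)_{k∈ℕ} sequences in X with x_{k+1} = λ·x_k + v_k and ‖v_k‖ ≤ C for all k. Let (k_n)_{n∈ℕ} be a strictly increasing sequence of natural numbers and (w_j)_{j∈ℕ} a sequence in X such that for every j ∈ ℕ, v_{k_n − j − 1} → w_j as n → ∞ (for n large enough that k_n ≥ j + 1). Then the subsequence (x_{k_n})_n converges in norm, with limit ∑_{j=0}^∞ λ^j · w_j. -/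
open Filter

/-- Equation (12) of the paper: for the recursion `x_{k+1} = λ x_k + v_k` in a Banach
space with `|λ| < 1` and `‖v_k‖ ≤ C`, if along a strictly increasing sequence of
indices `(k_n)` each shifted sequence `v_{k_n − j − 1}` converges to `w_j`, then the
subsequence `(x_{k_n})` converges in norm, with limit `∑_{j=0}^∞ λ^j w_j`. -/
theorem subseq_strong_convergence_of_recursion
    {X : Type*} [NormedAddCommGroup X] [NormedSpace ℝ X] [CompleteSpace X]
    (lam : ℝ) (hlam : |lam| < 1) (C : ℝ) (hC : 0 ≤ C)
    (x v : ℕ → X)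
    (hrec : ∀ k, x (k + 1) = lam • x k + v k)
    (hv : ∀ k, ‖v k‖ ≤ C)
    (kn : ℕ → ℕ) (hkn : StrictMono kn)
    (w : ℕ → X)
    (hconv : ∀ j, Tendsto (fun n => v (kn n - j - 1)) atTop (nhds (w j))) :
    Tendsto (fun n => x (kn n)) atTop (nhds (∑' j : ℕ, lam ^ j • w j)) := by
  have hsol : ∀ k, x k = lam ^ k • x 0 + ∑ j ∈ Finset.range k, lam ^ j • v (k - j - 1) := by
    intro k
    induction k with
    | zero => simp
    | succ k ih =>
      rw [hrec, ih, Finset.sum_range_succ', smul_add, Finset.smul_sum, smul_smul, ← pow_succ',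
        add_assoc]
      congr 2
      · apply Finset.sum_congr rfl
        intro j _
        rw [smul_smul, ← pow_succ']
        congr 2
        omega
      · simp
  have hk : Tendsto kn atTop atTop := hkn.tendsto_atTop
  have h1 : Tendsto (fun n => lam ^ (kn n) • x 0) atTop (nhds 0) := by
    have := ((tendsto_pow_atTop_nhds_zero_of_abs_lt_one hlam).comp hk).smul_const (x 0)
    simpa using this
  have h2 : Tendsto (fun n => ∑' j : ℕ, if j < kn n then lam ^ j • v (kn n - j - 1) else 0)
      atTop (nhds (∑' j : ℕ, lam ^ j • w j)) := by
    refine tendsto_tsum_of_dominated_convergence (bound := fun j => |lam| ^ j * C) ?_ ?_ ?_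
    · exact (summable_geometric_of_lt_one (abs_nonneg _) hlam).mul_right C
    · intro j
      refine ((hconv j).const_smul (lam ^ j)).congr' ?_
      filter_upwards [hk.eventually_gt_atTop j] with n hn
      rw [if_pos hn]
    · refine Eventually.of_forall fun n j => ?_
      split_ifs
      · rw [norm_smul, norm_pow, Real.norm_eq_abs]
        exact mul_le_mul_of_nonneg_left (hv _) (by positivity)
      · rw [norm_zero]
        positivity
  have h3 := h1.add h2
  rw [zero_add] at h3
  refine h3.congr fun n => ?_
  rw [hsol (kn n)]
  congr 1
  rw [tsum_eq_sum (s := Finset.range (kn n))]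
  · apply Finset.sum_congr rfl
    intro j hj
    rw [if_pos (Finset.mem_range.1 hj)]
  · intro j hj
    rw [if_neg (by simpa using hj)]
end

section
/- Let X be a metric space and (x_k)_{k∈ℕ} a sequence in X such that the closure of {x_k : k ∈ ℕ} is compact and dist(x_{k+1}, x_k) → 0 as k → ∞. Let A be the set of cluster points of (x_k). Then for every a, b ∈ A and every e > 0 there exists an e-string in A between a and b, i.e., a natural number N ≥ 1 and points z_0, z_1, …, z_N all belonging to A with z_0 = a, z_N = b, and dist(z_{i+1}, z_i) < e for all 0 ≤ i ≤ N−1. -/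
open Filter

/-- e-strings in the limit set: if the closure of the range of a sequence is compact
and `dist(x_{k+1}, x_k) → 0`, then any two cluster points `a, b` of the sequence can
be joined, for every `e > 0`, by an `e`-string lying in the set `A` of cluster
points: points `z_0 = a, z_1, …, z_N = b` in `A` with consecutive distances `< e`. -/
theorem e_string_in_limit_set
    {X : Type*} [MetricSpace X] (x : ℕ → X)
    (hcompact : IsCompact (closure (Set.range x)))
    (hdiff : Tendsto (fun k => dist (x (k + 1)) (x k)) atTop (nhds 0)) :
    ∀ a ∈ {p : X | ∃ φ : ℕ → ℕ, StrictMono φ ∧ Tendsto (x ∘ φ) atTop (nhds p)},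
    ∀ b ∈ {p : X | ∃ φ : ℕ → ℕ, StrictMono φ ∧ Tendsto (x ∘ φ) atTop (nhds p)},
    ∀ e > (0:ℝ), ∃ (N : ℕ) (z : ℕ → X), 1 ≤ N ∧
      z 0 = a ∧ z N = b ∧
      (∀ i ≤ N, z i ∈ {p : X | ∃ φ : ℕ → ℕ, StrictMono φ ∧
        Tendsto (x ∘ φ) atTop (nhds p)}) ∧
      (∀ i < N, dist (z (i + 1)) (z i) < e) := by
  intro a ha b hb e he
  set A := {p : X | ∃ φ : ℕ → ℕ, StrictMono φ ∧ Tendsto (x ∘ φ) atTop (nhds p)} with hA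
  have h3 : 0 < e / 3 := by positivity
  have h1 : ∀ᶠ k in atTop, ∃ p ∈ A, dist (x k) p < e / 3 := by
    by_contra hcon
    obtain ⟨φ, hφ, hφ2⟩ := extraction_of_frequently_atTop (not_eventually.mp hcon)
    obtain ⟨p, -, ψ, hψ, hlim⟩ := hcompact.tendsto_subseq
      (x := x ∘ φ) (fun n => subset_closure ⟨φ n, rfl⟩)
    have hp : p ∈ A := ⟨φ ∘ ψ, hφ.comp hψ, hlim⟩
    obtain ⟨n, hn⟩ := ((Metric.tendsto_nhds.mp hlim) _ h3).exists
    exact hφ2 (ψ n) ⟨p, hp, hn⟩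
  have h2 : ∀ᶠ k in atTop, dist (x (k + 1)) (x k) < e / 3 := hdiff.eventually_lt_const h3
  obtain ⟨K, hK⟩ := eventually_atTop.mp (h1.and h2)
  have key : ∀ p ∈ A, ∀ M, ∃ m ≥ M, dist (x m) p < e / 3 := by
    rintro p ⟨φ, hφ, hlim⟩ M
    obtain ⟨n, hn, hn2⟩ := (((Metric.tendsto_nhds.mp hlim) _ h3).and
      (eventually_ge_atTop M)).exists
    exact ⟨φ n, hn2.trans (hφ.id_le n), hn⟩
  obtain ⟨m, hm, hma⟩ := key a ha K
  obtain ⟨n, hn, hnb⟩ := key b hb (m + 1)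
  have hz : ∀ i, ∃ p ∈ A, dist (x (m + i)) p < e / 3 := fun i => (hK (m + i) (by omega)).1
  choose p hpA hp using hz
  let z : ℕ → X := fun i => if i = 0 then a else if i = n - m then b else p i
  have hzA : ∀ i, z i ∈ A := by
    intro i
    simp only [z]
    split_ifs
    exacts [ha, hb, hpA i]
  have hzd : ∀ i, dist (x (m + i)) (z i) < e / 3 := by
    intro i
    simp only [z]
    split_ifs with h h'
    · subst h; exact hma
    · rw [show m + i = n by omega]; exact hnb
    · exact hp i
  refine ⟨n - m, z, by omega, by simp [z], ?_, fun i _ => hzA i, fun i _ => ?_⟩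
  · have : n - m ≠ 0 := by omega
    simp [z, this]
  · have e1 := hzd (i + 1)
    have e2 := hzd i
    have e3 := (hK (m + i) (by omega)).2
    have t := dist_triangle4 (z (i + 1)) (x (m + (i + 1))) (x (m + i)) (z i)
    rw [dist_comm (z (i + 1)) (x _)] at t
    rw [← add_assoc] at t e1
    linarith
end

section
/- Let X be a metric space and (x_k)_{k∈ℕ} a sequence in X such that the closure of {x_k : k ∈ ℕ} is compact and dist(x_{k+1}, x_k) → 0 as k → ∞. Then the set A of cluster points of (x_k) is a nonempty connected subset of X. -/
open Filter

/-- Connectedness of the limit set: if the closure of the range of a sequence in a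
metric space is compact and `dist(x_{k+1}, x_k) → 0`, then the set of cluster points
of the sequence is nonempty and connected. -/
theorem limit_set_connected
    {X : Type*} [MetricSpace X] (x : ℕ → X)
    (hcompact : IsCompact (closure (Set.range x)))
    (hdiff : Tendsto (fun k => dist (x (k + 1)) (x k)) atTop (nhds 0)) :
    IsConnected {a : X | ∃ φ : ℕ → ℕ, StrictMono φ ∧
      Tendsto (x ∘ φ) atTop (nhds a)} := by
  have hK : ∀ n, x n ∈ closure (Set.range x) := fun n => subset_closure ⟨n, rfl⟩
  refine ⟨?_, ?_⟩
  · obtain ⟨a, _, φ, hφ, h⟩ := hcompact.tendsto_subseq hK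
    exact ⟨a, φ, hφ, h⟩
  rw [isPreconnected_closed_iff]
  rintro t t' ht ht' hsub ⟨a, ha, hat⟩ ⟨b, hb, hbt⟩
  by_cases hat' : a ∈ t'
  · exact ⟨a, ha, hat, hat'⟩
  by_cases hbt' : b ∈ t
  · exact ⟨b, hb, hbt', hbt⟩
  let f : X → ℝ := fun y => Metric.infDist y t - Metric.infDist y t'
  have hf : Continuous f :=
    (Metric.continuous_infDist_pt t).sub (Metric.continuous_infDist_pt t')
  have hfa : f a < 0 := by
    have h1 := Metric.infDist_zero_of_mem hat
    have h2 := (ht'.notMem_iff_infDist_pos ⟨b, hbt⟩).1 hat'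
    simp only [f]; linarith
  have hfb : 0 < f b := by
    have h1 := Metric.infDist_zero_of_mem hbt
    have h2 := (ht.notMem_iff_infDist_pos ⟨a, hat⟩).1 hbt'
    simp only [f]; linarith
  have hneg : ∃ᶠ k in atTop, f (x k) < 0 := by
    obtain ⟨φ, hφ, h⟩ := ha
    have h3 := ((hf.tendsto a).comp h).eventually (gt_mem_nhds hfa)
    exact hφ.tendsto_atTop.frequently h3.frequently
  have hpos : ∃ᶠ k in atTop, 0 < f (x k) := by
    obtain ⟨φ, hφ, h⟩ := hb
    have h3 := ((hf.tendsto b).comp h).eventually (lt_mem_nhds hfb)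
    exact hφ.tendsto_atTop.frequently h3.frequently
  have hcross : ∃ᶠ k in atTop, f (x k) ≤ 0 ∧ 0 < f (x (k + 1)) := by
    intro hno
    obtain ⟨N, hN⟩ := eventually_atTop.1 hno
    obtain ⟨k, hk, hk0⟩ := frequently_atTop.1 hneg N
    have hall : ∀ m, k ≤ m → f (x m) ≤ 0 := by
      intro m hm
      induction m, hm using Nat.le_induction with
      | base => exact hk0.le
      | succ m hm ih =>
        by_contra hc
        exact hN m (hk.trans hm) ⟨ih, not_le.1 hc⟩
    obtain ⟨m, hm, hm0⟩ := frequently_atTop.1 hpos k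
    exact absurd (hall m hm) (not_le.2 hm0)
  obtain ⟨φ, hφ, hφc⟩ := extraction_of_frequently_atTop hcross
  obtain ⟨z, _, ψ, hψ, hz⟩ := hcompact.tendsto_subseq (fun n => hK (φ n))
  have hθ : StrictMono (φ ∘ ψ) := hφ.comp hψ
  have hz1 : Tendsto (fun n => x (φ (ψ n) + 1)) atTop (nhds z) := by
    refine hz.congr_dist ?_
    have := hdiff.comp hθ.tendsto_atTop
    refine this.congr fun n => ?_
    simp [dist_comm]
  have hle : f z ≤ 0 := le_of_tendsto' ((hf.tendsto z).comp hz) fun n => (hφc (ψ n)).1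
  have hge : 0 ≤ f z := ge_of_tendsto' ((hf.tendsto z).comp hz1) fun n => (hφc (ψ n)).2.le
  have hzA : z ∈ {a : X | ∃ φ : ℕ → ℕ, StrictMono φ ∧
      Tendsto (x ∘ φ) atTop (nhds a)} := ⟨φ ∘ ψ, hθ, hz⟩
  refine ⟨z, hzA, ?_⟩
  simp only [f] at hle hge
  rcases hsub hzA with h | h
  · refine ⟨h, (ht'.mem_iff_infDist_zero ⟨b, hbt⟩).2 ?_⟩
    have := Metric.infDist_zero_of_mem h
    linarith
  · refine ⟨(ht.mem_iff_infDist_zero ⟨a, hat⟩).2 ?_, h⟩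
    have := Metric.infDist_zero_of_mem h
    linarith
end

section
/- Let T ≥ 1, M > 0, and let ε, ε' : [0,T] → ℝ be continuous controls with |ε'(t)| ≤ M for all t. Let ψ be the state with control ε and initial datum ψ₀ and ψ' the state with control ε' and initial datum ψ₀, where ‖ψ₀‖ = 1. Then for all t ∈ [0,T], ‖ψ(t) − ψ'(t)‖ ≤ ‖μ‖·T·e^{T‖μ‖M}·∫₀ᵀ |ε(s) − ε'(s)| ds. -/
open MeasureTheory Set

theorem aux_re_inner {E : Type*} [NormedAddCommGroup E] [InnerProductSpace ℂ E] [CompleteSpace E]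
    (H μ : E →L[ℂ] E) (hH : IsSelfAdjoint H) (hμ : IsSelfAdjoint μ) (c : ℝ) (x : E) :
    (inner ℂ x ((-Complex.I) • (H - c • μ) x)).re = 0 := by
  have hA : IsSelfAdjoint (H - c • μ) := hH.sub ((IsSelfAdjoint.all c).smul hμ)
  have hs := hA.isSymmetric
  have h1 := hs.im_inner_self_apply x
  rw [inner_smul_right]
  simpa using h1

theorem aux_norm_sq {E : Type*} [NormedAddCommGroup E] [InnerProductSpace ℂ E]
    {f : ℝ → E} {f' : E} {x : ℝ} (h : HasDerivAt f f' x) :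
    HasDerivAt (fun t => ‖f t‖ ^ 2) (2 * (inner ℂ (f x) f').re) x := by
  letI : InnerProductSpace ℝ E := InnerProductSpace.rclikeToReal ℂ E
  exact HasDerivAt.norm_sq h

/-- Estimate (8) of the paper: variation of the state with respect to the control,
via Gronwall's lemma:
`‖ψ(t) − ψ'(t)‖ ≤ ‖μ‖ T e^{T‖μ‖M} ∫₀ᵀ |ε(s) − ε'(s)| ds`. -/
theorem state_variation_estimate
    {E : Type*} [NormedAddCommGroup E] [InnerProductSpace ℂ E] [CompleteSpace E]
    (H μ : E →L[ℂ] E) (hH : IsSelfAdjoint H) (hμ : IsSelfAdjoint μ)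
    (T M : ℝ) (hT : 1 ≤ T) (hM : 0 < M)
    (ε ε' : ℝ → ℝ)
    (hεc : ContinuousOn ε (Set.Icc 0 T)) (hε'c : ContinuousOn ε' (Set.Icc 0 T))
    (hε'M : ∀ t ∈ Set.Icc (0:ℝ) T, |ε' t| ≤ M)
    (ψ₀ : E) (hψ₀ : ‖ψ₀‖ = 1)
    (ψ ψ' : ℝ → E)
    (hψ : ∀ t ∈ Set.Icc (0:ℝ) T,
      HasDerivAt ψ ((-Complex.I) • (H - ε t • μ) (ψ t)) t)
    (hψ0 : ψ 0 = ψ₀)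
    (hψ' : ∀ t ∈ Set.Icc (0:ℝ) T,
      HasDerivAt ψ' ((-Complex.I) • (H - ε' t • μ) (ψ' t)) t)
    (hψ'0 : ψ' 0 = ψ₀) :
    ∀ t ∈ Set.Icc (0:ℝ) T,
      ‖ψ t - ψ' t‖ ≤ ‖μ‖ * T * Real.exp (T * ‖μ‖ * M) *
        ∫ s in (0:ℝ)..T, |ε s - ε' s| := by
  have hn : ∀ t ∈ Set.Icc (0:ℝ) T, ‖ψ t‖ = 1 := by
    intro t ht
    have hc : ∀ x ∈ Icc (0:ℝ) T, HasDerivAt (fun t => ‖ψ t‖ ^ 2) 0 x := by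
      intro x hx
      have := aux_norm_sq (hψ x hx)
      rwa [aux_re_inner H μ hH hμ, mul_zero] at this
    have h2 := constant_of_has_deriv_right_zero
      (f := fun t => ‖ψ t‖ ^ 2) (a := 0) (b := T)
      (fun x hx => (hc x hx).continuousAt.continuousWithinAt)
      (fun x hx => (hc x (Ico_subset_Icc_self hx)).hasDerivWithinAt) t ht
    simp only [hψ0, hψ₀] at h2
    nlinarith [norm_nonneg (ψ t)]
  have hcont : ContinuousOn (fun s => |ε s - ε' s|) (Icc 0 T) := (hεc.sub hε'c).abs
  have hint : IntervalIntegrable (fun s => |ε s - ε' s|) volume 0 T :=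
    ContinuousOn.intervalIntegrable (by rwa [uIcc_of_le (by linarith)])
  have hI0 : 0 ≤ ∫ s in (0:ℝ)..T, |ε s - ε' s| :=
    intervalIntegral.integral_nonneg (by linarith) (fun _ _ => abs_nonneg _)
  have key : ∀ t ∈ Icc (0:ℝ) T, ‖ψ t - ψ' t‖ ≤ ‖μ‖ * ∫ s in (0:ℝ)..T, |ε s - ε' s| := by
    intro t ht
    have hmono : ∫ s in (0:ℝ)..t, |ε s - ε' s| ≤ ∫ s in (0:ℝ)..T, |ε s - ε' s| :=
      intervalIntegral.integral_mono_interval le_rfl ht.1 ht.2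
        (Filter.Eventually.of_forall fun _ => abs_nonneg _) hint
    refine le_trans ?_ (mul_le_mul_of_nonneg_left hmono (norm_nonneg _))
    apply le_of_forall_pos_le_add
    intro η hη
    have hpos : ∀ x, 0 < ‖ψ x - ψ' x‖ ^ 2 + η ^ 2 := fun x => by positivity
    have hd : ∀ x ∈ Icc (0:ℝ) T, HasDerivAt (fun x => √(‖ψ x - ψ' x‖ ^ 2 + η ^ 2))
        ((2 * (inner ℂ (ψ x - ψ' x) ((-Complex.I) • (H - ε x • μ) (ψ x)
          - (-Complex.I) • (H - ε' x • μ) (ψ' x))).re) / (2 * √(‖ψ x - ψ' x‖ ^ 2 + η ^ 2))) x := by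
      intro x hx
      exact ((aux_norm_sq ((hψ x hx).sub (hψ' x hx))).add_const (η ^ 2)).sqrt (hpos x).ne'
    have hsub : Icc 0 t ⊆ Icc 0 T := Icc_subset_Icc_right ht.2
    have h3 := intervalIntegral.sub_le_integral_of_hasDeriv_right_of_le ht.1
      (φ := fun s => ‖μ‖ * |ε s - ε' s|)
      (fun x hx => (hd x (hsub hx)).continuousAt.continuousWithinAt)
      (fun x hx => (hd x (hsub (Ioo_subset_Icc_self hx))).hasDerivWithinAt)
      (((hcont.mono hsub).const_mul ‖μ‖).integrableOn_Icc)
      (by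
        intro x hx
        have hx' := hsub (Ioo_subset_Icc_self hx)
        have hsq := Real.sqrt_pos.2 (hpos x)
        have hle : ‖ψ x - ψ' x‖ ≤ √(‖ψ x - ψ' x‖ ^ 2 + η ^ 2) :=
          Real.le_sqrt_of_sq_le (by nlinarith [sq_nonneg η])
        have heq : (-Complex.I) • (H - ε x • μ) (ψ x) - (-Complex.I) • (H - ε' x • μ) (ψ' x)
            = (-Complex.I) • (H - ε' x • μ) (ψ x - ψ' x)
              + (-Complex.I) • (-(ε x - ε' x) • μ (ψ x)) := by
          rw [← smul_sub, ← smul_add]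
          congr 1
          simp only [sub_apply, smul_apply, map_sub]
          module
        rw [div_le_iff₀ (by positivity), heq, inner_add_right, Complex.add_re, aux_re_inner H μ hH hμ, zero_add]
        have h5 := re_inner_le_norm (𝕜 := ℂ) (ψ x - ψ' x) ((-Complex.I) • (-(ε x - ε' x) • μ (ψ x)))
        rw [RCLike.re_eq_complex_re] at h5
        have h6 : ‖(-Complex.I) • (-(ε x - ε' x) • μ (ψ x))‖ ≤ ‖μ‖ * |ε x - ε' x| := by
          rw [norm_smul, norm_smul, norm_neg, Complex.norm_I, one_mul, norm_neg, Real.norm_eq_abs,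
            mul_comm]
          have := μ.le_opNorm (ψ x)
          rw [hn x hx', mul_one] at this
          gcongr
        have h7 := mul_le_mul hle h6 (norm_nonneg _) hsq.le
        linarith)
    have h8 : ‖ψ t - ψ' t‖ ≤ √(‖ψ t - ψ' t‖ ^ 2 + η ^ 2) :=
      Real.le_sqrt_of_sq_le (by nlinarith [sq_nonneg η])
    rw [intervalIntegral.integral_const_mul] at h3
    simp only [hψ0, hψ'0, sub_self, norm_zero] at h3
    rw [show (0:ℝ) ^ 2 + η ^ 2 = η ^ 2 by ring, Real.sqrt_sq hη.le] at h3
    linarith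
  intro t ht
  refine (key t ht).trans ?_
  apply mul_le_mul_of_nonneg_right _ hI0
  have h9 : 1 ≤ Real.exp (T * ‖μ‖ * M) := Real.one_le_exp (by positivity)
  rw [mul_assoc]
  exact le_mul_of_one_le_right (norm_nonneg _) (one_le_mul_of_one_le_of_one_le hT h9)
end

section
/- Let T ≥ 1, M > 0, and let ε, ε' : [0,T] → ℝ be continuous controls with |ε(t)| ≤ M and |ε'(t)| ≤ M for all t. Let ψ be the state with control ε and initial datum ψ₀ and ψ' the state with control ε' and initial datum ψ₀, where ‖ψ₀‖ = 1. Let O be a continuous linear operator on E, and let χ, χ' : [0,T] → E be differentiable functions satisfying i·χ'(t) = (H − ε(t)·μ)(χ(t)) with χ(T) = O ψ(T), and i·(χ')'(t) = (H − ε'(t)·μ)(χ'(t)) with χ'(T) = O ψ'(T). Then for all t ∈ [0,T], ‖χ(t) − χ'(t)‖ ≤ ‖O‖·‖μ‖·T·(1 + e^{T‖μ‖M})·e^{T‖μ‖M}·∫₀ᵀ |ε(s) − ε'(s)| ds. -/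
open MeasureTheory Set

lemma aux_growth {F : Type*} [NormedAddCommGroup F] [InnerProductSpace ℝ F]
    (T : ℝ) (w v : ℝ → F) (b : ℝ → ℝ)
    (hw : ∀ t ∈ Set.Icc (0:ℝ) T, HasDerivAt w (v t) t)
    (hv : ContinuousOn v (Set.Icc 0 T)) (hb : ContinuousOn b (Set.Icc 0 T))
    (hb0 : ∀ t ∈ Set.Icc (0:ℝ) T, 0 ≤ b t)
    (h : ∀ t ∈ Set.Icc (0:ℝ) T, |inner ℝ (w t) (v t)| ≤ ‖w t‖ * b t)
    (s t : ℝ) (hs : s ∈ Set.Icc (0:ℝ) T) (ht : t ∈ Set.Icc (0:ℝ) T) :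
    ‖w t‖ ≤ ‖w s‖ + ∫ x in (0:ℝ)..T, b x := by
  have hT : (0:ℝ) ≤ T := hs.1.trans hs.2
  apply le_of_forall_pos_le_add
  intro δ hδ
  have hpos : ∀ x, 0 < ‖w x‖ ^ 2 + δ ^ 2 := fun x => by positivity
  have hsub : Set.uIcc s t ⊆ Set.Icc 0 T := Set.uIcc_subset_Icc hs ht
  have hsub' : Set.uIoc s t ⊆ Set.Ioc 0 T := by
    intro x hx
    rw [Set.mem_uIoc] at hx
    rcases hx with hx | hx
    · exact ⟨hs.1.trans_lt hx.1, hx.2.trans ht.2⟩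
    · exact ⟨ht.1.trans_lt hx.1, hx.2.trans hs.2⟩
  have hwc : ContinuousOn w (Set.Icc 0 T) := fun x hx => (hw x hx).continuousAt.continuousWithinAt
  have hg : ∀ x ∈ Set.Icc (0:ℝ) T, HasDerivAt (fun x => Real.sqrt (‖w x‖ ^ 2 + δ ^ 2))
      ((2 * inner ℝ (w x) (v x)) / (2 * Real.sqrt (‖w x‖ ^ 2 + δ ^ 2))) x := by
    intro x hx
    exact (((hw x hx).norm_sq).add_const (δ ^ 2)).sqrt (hpos x).ne'
  have hgc : ContinuousOn (fun x => (2 * inner ℝ (w x) (v x)) /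
      (2 * Real.sqrt (‖w x‖ ^ 2 + δ ^ 2))) (Set.Icc 0 T) := by
    apply ContinuousOn.div
    · exact continuousOn_const.mul (hwc.inner hv)
    · exact continuousOn_const.mul ((hwc.norm.pow 2).add continuousOn_const).sqrt
    · intro x _
      have := Real.sqrt_pos.2 (hpos x)
      positivity
  have hbound : ∀ x ∈ Set.Icc (0:ℝ) T, ‖(2 * inner ℝ (w x) (v x)) /
      (2 * Real.sqrt (‖w x‖ ^ 2 + δ ^ 2))‖ ≤ b x := by
    intro x hx
    have h1 := Real.sqrt_pos.2 (hpos x)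
    have h2 : ‖w x‖ ≤ Real.sqrt (‖w x‖ ^ 2 + δ ^ 2) := by
      apply Real.le_sqrt_of_sq_le
      nlinarith
    rw [mul_div_mul_left _ _ two_ne_zero, norm_div, Real.norm_eq_abs, Real.norm_eq_abs,
      abs_of_pos h1, div_le_iff₀ h1]
    have := mul_le_mul_of_nonneg_right h2 (hb0 x hx)
    linarith [h x hx]
  have hbi : IntegrableOn b (Set.Ioc 0 T) :=
    (hb.integrableOn_Icc).mono_set Set.Ioc_subset_Icc_self
  have key := intervalIntegral.integral_eq_sub_of_hasDerivAt (a := s) (b := t)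
    (fun x hx => hg x (hsub hx)) ((hgc.mono hsub).intervalIntegrable)
  have h3 := intervalIntegral.norm_integral_le_integral_norm_uIoc (a := s) (b := t) (μ := volume)
    (f := fun x => (2 * inner ℝ (w x) (v x)) / (2 * Real.sqrt (‖w x‖ ^ 2 + δ ^ 2)))
  have h4 : ∫ x in Set.uIoc s t, ‖(2 * inner ℝ (w x) (v x)) /
      (2 * Real.sqrt (‖w x‖ ^ 2 + δ ^ 2))‖ ≤ ∫ x in Set.uIoc s t, b x := by
    apply setIntegral_mono_on
    · exact ((hgc.norm.integrableOn_Icc).mono_set Set.Ioc_subset_Icc_self).mono_set hsub'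
    · exact hbi.mono_set hsub'
    · exact measurableSet_uIoc
    · intro x hx
      exact hbound x (Set.Ioc_subset_Icc_self (hsub' hx))
  have h5 : ∫ x in Set.uIoc s t, b x ≤ ∫ x in Set.Ioc 0 T, b x := by
    apply setIntegral_mono_set hbi
    · filter_upwards [ae_restrict_mem measurableSet_Ioc] with x hx
      exact hb0 x (Set.Ioc_subset_Icc_self hx)
    · exact hsub'.eventuallyLE
  rw [key] at h3
  rw [intervalIntegral.integral_of_le hT]
  have h6 := (le_abs_self _).trans h3
  have h7 : ‖w t‖ ≤ Real.sqrt (‖w t‖ ^ 2 + δ ^ 2) := by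
    apply Real.le_sqrt_of_sq_le
    nlinarith
  have h8 : Real.sqrt (‖w s‖ ^ 2 + δ ^ 2) ≤ ‖w s‖ + δ := by
    apply Real.sqrt_le_iff.2
    have := norm_nonneg (w s)
    constructor
    · positivity
    · nlinarith
  linarith

lemma aux_growth_c {E : Type*} [NormedAddCommGroup E] [InnerProductSpace ℂ E]
    (T : ℝ) (w v : ℝ → E) (b : ℝ → ℝ)
    (hw : ∀ t ∈ Set.Icc (0:ℝ) T, HasDerivAt w (v t) t)
    (hv : ContinuousOn v (Set.Icc 0 T)) (hb : ContinuousOn b (Set.Icc 0 T))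
    (hb0 : ∀ t ∈ Set.Icc (0:ℝ) T, 0 ≤ b t)
    (h : ∀ t ∈ Set.Icc (0:ℝ) T, |(inner ℂ (w t) (v t)).re| ≤ ‖w t‖ * b t)
    (s t : ℝ) (hs : s ∈ Set.Icc (0:ℝ) T) (ht : t ∈ Set.Icc (0:ℝ) T) :
    ‖w t‖ ≤ ‖w s‖ + ∫ x in (0:ℝ)..T, b x := by
  letI := InnerProductSpace.rclikeToReal ℂ E
  exact aux_growth T w v b hw hv hb hb0 h s t hs ht

lemma aux_skew {E : Type*} [NormedAddCommGroup E] [InnerProductSpace ℂ E] [CompleteSpace E]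
    (H μ : E →L[ℂ] E) (hH : IsSelfAdjoint H) (hμ : IsSelfAdjoint μ) (e : ℝ) (x : E) :
    (inner ℂ x ((-Complex.I) • (H - e • μ) x)).re = 0 := by
  have hA : IsSelfAdjoint (H - e • μ) := hH.sub ((IsSelfAdjoint.all e).smul hμ)
  have h := hA.isSymmetric.im_inner_self_apply x
  rw [inner_smul_right]
  have h2 : (inner ℂ x ((H - e • μ) x)).im = 0 := h
  rw [Complex.mul_re, h2]
  simp

lemma aux_cont {E : Type*} [NormedAddCommGroup E] [InnerProductSpace ℂ E]
    (H μ : E →L[ℂ] E) (T : ℝ) (e : ℝ → ℝ) (x : ℝ → E)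
    (he : ContinuousOn e (Set.Icc 0 T)) (hx : ContinuousOn x (Set.Icc 0 T)) :
    ContinuousOn (fun t => (-Complex.I) • (H - e t • μ) (x t)) (Set.Icc 0 T) := by
  have : ContinuousOn (fun t => H - e t • μ) (Set.Icc 0 T) :=
    continuousOn_const.sub (he.smul continuousOn_const)
  exact (this.clm_apply hx).const_smul _

lemma aux_const {E : Type*} [NormedAddCommGroup E] [InnerProductSpace ℂ E] [CompleteSpace E]
    (H μ : E →L[ℂ] E) (hH : IsSelfAdjoint H) (hμ : IsSelfAdjoint μ) (T : ℝ) (e : ℝ → ℝ)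
    (he : ContinuousOn e (Set.Icc 0 T)) (x : ℝ → E)
    (hx : ∀ t ∈ Set.Icc (0:ℝ) T, HasDerivAt x ((-Complex.I) • (H - e t • μ) (x t)) t)
    (s t : ℝ) (hs : s ∈ Set.Icc (0:ℝ) T) (ht : t ∈ Set.Icc (0:ℝ) T) : ‖x t‖ ≤ ‖x s‖ := by
  have hxc : ContinuousOn x (Set.Icc 0 T) := fun t h => (hx t h).continuousAt.continuousWithinAt
  have := aux_growth_c T x _ (fun _ => 0) hx (aux_cont H μ T e x he hxc) continuousOn_const
    (fun _ _ => le_rfl) (fun t _ => by rw [aux_skew H μ hH hμ]; simp) s t hs ht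
  simpa using this

lemma aux_diff {E : Type*} [NormedAddCommGroup E] [InnerProductSpace ℂ E] [CompleteSpace E]
    (H μ : E →L[ℂ] E) (hH : IsSelfAdjoint H) (hμ : IsSelfAdjoint μ) (T : ℝ) (e e' : ℝ → ℝ)
    (he : ContinuousOn e (Set.Icc 0 T)) (he' : ContinuousOn e' (Set.Icc 0 T)) (x y : ℝ → E)
    (hx : ∀ t ∈ Set.Icc (0:ℝ) T, HasDerivAt x ((-Complex.I) • (H - e t • μ) (x t)) t)
    (hy : ∀ t ∈ Set.Icc (0:ℝ) T, HasDerivAt y ((-Complex.I) • (H - e' t • μ) (y t)) t)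
    (c : ℝ) (hc0 : 0 ≤ c) (hc : ∀ t ∈ Set.Icc (0:ℝ) T, ‖y t‖ ≤ c)
    (s t : ℝ) (hs : s ∈ Set.Icc (0:ℝ) T) (ht : t ∈ Set.Icc (0:ℝ) T) :
    ‖x t - y t‖ ≤ ‖x s - y s‖ + ‖μ‖ * c * ∫ r in (0:ℝ)..T, |e r - e' r| := by
  have hxc : ContinuousOn x (Set.Icc 0 T) := fun t h => (hx t h).continuousAt.continuousWithinAt
  have hyc : ContinuousOn y (Set.Icc 0 T) := fun t h => (hy t h).continuousAt.continuousWithinAt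
  have := aux_growth_c T (fun t => x t - y t)
    (fun t => (-Complex.I) • (H - e t • μ) (x t) - (-Complex.I) • (H - e' t • μ) (y t)) (fun r => ‖μ‖ * c * |e r - e' r|)
    (fun t ht => (hx t ht).sub (hy t ht))
    ((aux_cont H μ T e x he hxc).sub (aux_cont H μ T e' y he' hyc))
    (continuousOn_const.mul (he.sub he').abs)
    (fun _ _ => by positivity) (fun t ht => by
      have h1 : (-Complex.I) • (H - e t • μ) (x t) - (-Complex.I) • (H - e' t • μ) (y t)
          = (-Complex.I) • (H - e t • μ) (x t - y t)
            + (-Complex.I) • ((e' t - e t) • μ (y t)) := by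
        rw [← smul_sub, ← smul_add]
        congr 1
        simp only [map_sub, _root_.sub_apply, _root_.smul_apply,
          sub_smul]
        abel
      rw [h1, inner_add_right, Complex.add_re, aux_skew H μ hH hμ, zero_add]
      refine (Complex.abs_re_le_norm _).trans ((norm_inner_le_norm _ _).trans ?_)
      apply mul_le_mul_of_nonneg_left _ (norm_nonneg _)
      rw [norm_smul, norm_smul, norm_neg, Complex.norm_I, one_mul, Real.norm_eq_abs,
        abs_sub_comm, mul_comm]
      apply mul_le_mul_of_nonneg_right _ (abs_nonneg _)
      exact (μ.le_opNorm _).trans (mul_le_mul_of_nonneg_left (hc t ht) (norm_nonneg _))) s t hs ht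
  simpa only [intervalIntegral.integral_const_mul] using this

/-- Estimate (9) of the paper: variation of the adjoint state with respect to the
control:
`‖χ(t) − χ'(t)‖ ≤ ‖O‖‖μ‖T(1 + e^{T‖μ‖M})e^{T‖μ‖M} ∫₀ᵀ |ε(s) − ε'(s)| ds`. -/
theorem adjoint_state_variation_estimate
    {E : Type*} [NormedAddCommGroup E] [InnerProductSpace ℂ E] [CompleteSpace E]
    (H μ O : E →L[ℂ] E) (hH : IsSelfAdjoint H) (hμ : IsSelfAdjoint μ)
    (T M : ℝ) (hT : 1 ≤ T) (hM : 0 < M)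
    (ε ε' : ℝ → ℝ)
    (hεc : ContinuousOn ε (Set.Icc 0 T)) (hε'c : ContinuousOn ε' (Set.Icc 0 T))
    (hεM : ∀ t ∈ Set.Icc (0:ℝ) T, |ε t| ≤ M)
    (hε'M : ∀ t ∈ Set.Icc (0:ℝ) T, |ε' t| ≤ M)
    (ψ₀ : E) (hψ₀ : ‖ψ₀‖ = 1)
    (ψ ψ' χ χ' : ℝ → E)
    (hψ : ∀ t ∈ Set.Icc (0:ℝ) T,
      HasDerivAt ψ ((-Complex.I) • (H - ε t • μ) (ψ t)) t)
    (hψ0 : ψ 0 = ψ₀)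
    (hψ' : ∀ t ∈ Set.Icc (0:ℝ) T,
      HasDerivAt ψ' ((-Complex.I) • (H - ε' t • μ) (ψ' t)) t)
    (hψ'0 : ψ' 0 = ψ₀)
    (hχ : ∀ t ∈ Set.Icc (0:ℝ) T,
      HasDerivAt χ ((-Complex.I) • (H - ε t • μ) (χ t)) t)
    (hχT : χ T = O (ψ T))
    (hχ' : ∀ t ∈ Set.Icc (0:ℝ) T,
      HasDerivAt χ' ((-Complex.I) • (H - ε' t • μ) (χ' t)) t)
    (hχ'T : χ' T = O (ψ' T)) :
    ∀ t ∈ Set.Icc (0:ℝ) T,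
      ‖χ t - χ' t‖ ≤ ‖O‖ * ‖μ‖ * T * (1 + Real.exp (T * ‖μ‖ * M)) *
        Real.exp (T * ‖μ‖ * M) * ∫ s in (0:ℝ)..T, |ε s - ε' s| := by
  intro t ht
  have h0 : (0:ℝ) ∈ Set.Icc (0:ℝ) T := ⟨le_rfl, by linarith⟩
  have hTT : T ∈ Set.Icc (0:ℝ) T := ⟨by linarith, le_rfl⟩
  have hy : ∀ r ∈ Set.Icc (0:ℝ) T, ‖ψ' r‖ ≤ 1 := fun r hr => by
    have := aux_const H μ hH hμ T ε' hε'c ψ' hψ' 0 r h0 hr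
    rwa [hψ'0, hψ₀] at this
  have hz : ∀ r ∈ Set.Icc (0:ℝ) T, ‖χ' r‖ ≤ ‖O‖ := fun r hr => by
    have := aux_const H μ hH hμ T ε' hε'c χ' hχ' T r hTT hr
    rw [hχ'T] at this
    exact this.trans (O.le_opNorm_of_le (hy T hTT) |>.trans (by simp))
  have h1 := aux_diff H μ hH hμ T ε ε' hεc hε'c ψ ψ' hψ hψ' 1 zero_le_one hy 0 T h0 hTT
  have h2 := aux_diff H μ hH hμ T ε ε' hεc hε'c χ χ' hχ hχ' ‖O‖ (norm_nonneg _) hz T t hTT ht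
  rw [hψ0, hψ'0, sub_self, norm_zero, zero_add, mul_one] at h1
  rw [hχT, hχ'T, ← map_sub] at h2
  have h3 := O.le_opNorm_of_le h1
  have hI : 0 ≤ ∫ s in (0:ℝ)..T, |ε s - ε' s| :=
    intervalIntegral.integral_nonneg (by linarith) (fun _ _ => abs_nonneg _)
  set I := ∫ s in (0:ℝ)..T, |ε s - ε' s|
  have he : 1 ≤ Real.exp (T * ‖μ‖ * M) := by
    apply Real.one_le_exp
    positivity
  set X := Real.exp (T * ‖μ‖ * M)
  have h4 : (2:ℝ) ≤ T * (1 + X) * X := by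
    have a : 1 + 1 ≤ (1 + X) := by linarith
    have b : 1 * (1 + X) ≤ T * (1 + X) := by gcongr
    have c : T * (1 + X) * 1 ≤ T * (1 + X) * X := by gcongr
    linarith
  have h5 : (‖O‖ * ‖μ‖ * I) * 2 ≤ (‖O‖ * ‖μ‖ * I) * (T * (1 + X) * X) := by gcongr
  calc _ ≤ (‖O‖ * ‖μ‖ * I) * 2 := by linarith
    _ ≤ _ := h5
    _ = _ := by ring
end

section
/- Let T ≥ 1, α > 0, M > 0, and suppose O is self-adjoint. Let ε, ε' : [0,T] → ℝ be continuous controls with |ε(t)| ≤ M and |ε'(t)| ≤ M for all t. Let ψ, ψ' be the states with controls ε, ε' respectively and common initial datum ψ₀ with ‖ψ₀‖ = 1, and let χ, χ' : [0,T] → E be differentiable functions satisfying i·χ'(t) = (H − ε(t)·μ)(χ(t)) with χ(T) = O ψ(T) and i·(χ')'(t) = (H − ε'(t)·μ)(χ'(t)) with χ'(T) = O ψ'(T). Assume both pairs satisfy the critical point equation: α·ε(t) = −Im⟨χ(t), μ ψ(t)⟩ and α·ε'(t) = −Im⟨χ'(t), μ ψ'(t)⟩ for all t ∈ [0,T]. If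 α > ‖O‖·‖μ‖²·T²·(1 + e^{T‖μ‖M})·e^{2T‖μ‖M}, then ε(t) = ε'(t) for all t ∈ [0,T]. -/
open MeasureTheory Set

theorem aux_norm_growth {E : Type*} [NormedAddCommGroup E] [InnerProductSpace ℂ E]
    [CompleteSpace E] (A : ℝ → E →L[ℂ] E) (hA : ∀ t, IsSelfAdjoint (A t))
    (T C : ℝ) (w f : ℝ → E)
    (hw : ∀ t ∈ Set.Icc (0:ℝ) T, HasDerivAt w ((-Complex.I) • A t (w t) + f t) t)
    (hf : ∀ t ∈ Set.Icc (0:ℝ) T, ‖f t‖ ≤ C)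
    (s t : ℝ) (hs : s ∈ Set.Icc (0:ℝ) T) (ht : t ∈ Set.Icc (0:ℝ) T) :
    ‖w t‖ ≤ ‖w s‖ + C * |t - s| := by
  apply le_of_forall_pos_le_add
  intro η hη
  have hpos : ∀ r, 0 < ‖w r‖ ^ 2 + η ^ 2 := fun r => by positivity
  have hsq : ∀ r ∈ Set.Icc (0:ℝ) T,
      HasDerivAt (fun r => ‖w r‖ ^ 2) (2 * (inner ℂ (w r) (f r) : ℂ).re) r := by
    intro r hr
    have h1 := (hw r hr).inner ℂ (hw r hr)
    have h2 := Complex.reCLM.hasFDerivAt.comp_hasDerivAt r h1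
    have e : (fun r => ‖w r‖ ^ 2) = (Complex.reCLM ∘ fun t => inner ℂ (w t) (w t)) := by
      funext r
      simp only [Function.comp, Complex.reCLM_apply]
      exact (inner_self_eq_norm_sq (𝕜 := ℂ) (w r)).symm
    rw [e]
    refine h2.congr_deriv ?_
    have him : (inner ℂ (w r) (A r (w r)) : ℂ).im = 0 := by
      have h3 : (inner ℂ (A r (w r)) (w r) : ℂ) = inner ℂ (w r) (A r (w r)) :=
        (ContinuousLinearMap.isSelfAdjoint_iff_isSymmetric.1 (hA r)) (w r) (w r)
      have h4 := inner_conj_symm (𝕜 := ℂ) (w r) (A r (w r))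
      rw [h3] at h4
      exact Complex.conj_eq_iff_im.1 h4
    have hre : (inner ℂ (f r) (w r) : ℂ).re = (inner ℂ (w r) (f r) : ℂ).re :=
      inner_re_symm (𝕜 := ℂ) _ _
    have him2 : (inner ℂ (A r (w r)) (w r) : ℂ).im = 0 := by
      rw [← inner_conj_symm, Complex.conj_im, him, neg_zero]
    simp only [Complex.reCLM_apply, inner_add_left, inner_add_right, inner_smul_left,
      inner_smul_right, Complex.add_re, Complex.mul_re, hre, him, him2]
    simp
    ring
  have hg : ∀ r ∈ Set.Icc (0:ℝ) T,
      HasDerivWithinAt (fun r => √(‖w r‖ ^ 2 + η ^ 2))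
        ((2 * (inner ℂ (w r) (f r) : ℂ).re) / (2 * √(‖w r‖ ^ 2 + η ^ 2))) (Set.Icc 0 T) r := by
    intro r hr
    exact (((hsq r hr).add_const (η ^ 2)).sqrt (hpos r).ne').hasDerivWithinAt
  have hb : ∀ r ∈ Set.Icc (0:ℝ) T,
      ‖(2 * (inner ℂ (w r) (f r) : ℂ).re) / (2 * √(‖w r‖ ^ 2 + η ^ 2))‖ ≤ C := by
    intro r hr
    have hp : 0 < √(‖w r‖ ^ 2 + η ^ 2) := Real.sqrt_pos.2 (hpos r)
    have hle : ‖w r‖ ≤ √(‖w r‖ ^ 2 + η ^ 2) := Real.le_sqrt_of_sq_le (by nlinarith)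
    have hC := hf r hr
    rw [mul_div_mul_left _ _ (two_ne_zero), Real.norm_eq_abs, abs_div, abs_of_pos hp,
      div_le_iff₀ hp]
    calc |(inner ℂ (w r) (f r) : ℂ).re| ≤ ‖(inner ℂ (w r) (f r) : ℂ)‖ := Complex.abs_re_le_norm _
      _ ≤ ‖w r‖ * ‖f r‖ := norm_inner_le_norm _ _
      _ ≤ √(‖w r‖ ^ 2 + η ^ 2) * C := by gcongr
      _ = _ := mul_comm _ _
  have key := (convex_Icc (0:ℝ) T).norm_image_sub_le_of_norm_hasDerivWithin_le hg hb hs ht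
  rw [Real.norm_eq_abs, Real.norm_eq_abs] at key
  have k1 := (abs_le.1 key).2
  have k2 : ‖w t‖ ≤ √(‖w t‖ ^ 2 + η ^ 2) := Real.le_sqrt_of_sq_le (by nlinarith)
  have k3 : √(‖w s‖ ^ 2 + η ^ 2) ≤ ‖w s‖ + η := by
    apply Real.sqrt_le_iff.2
    have := norm_nonneg (w s)
    constructor
    · positivity
    · nlinarith [mul_nonneg this hη.le]
  linarith

theorem aux_selfadj {E : Type*} [NormedAddCommGroup E] [InnerProductSpace ℂ E]
    [CompleteSpace E] (H μ : E →L[ℂ] E) (hH : IsSelfAdjoint H) (hμ : IsSelfAdjoint μ) (c : ℝ) :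
    IsSelfAdjoint (H - c • μ) :=
  hH.sub ((IsSelfAdjoint.all c).smul hμ)

theorem aux_norm_cons {E : Type*} [NormedAddCommGroup E] [InnerProductSpace ℂ E]
    [CompleteSpace E] (H μ : E →L[ℂ] E) (hH : IsSelfAdjoint H) (hμ : IsSelfAdjoint μ)
    (T : ℝ) (ε : ℝ → ℝ) (ψ : ℝ → E)
    (hψ : ∀ t ∈ Set.Icc (0:ℝ) T,
      HasDerivAt ψ ((-Complex.I) • (H - ε t • μ) (ψ t)) t)
    (s t : ℝ) (hs : s ∈ Set.Icc (0:ℝ) T) (ht : t ∈ Set.Icc (0:ℝ) T) :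
    ‖ψ t‖ ≤ ‖ψ s‖ := by
  have := aux_norm_growth (fun t => H - ε t • μ) (fun t => aux_selfadj H μ hH hμ _) T 0 ψ
    (fun _ => 0) (fun t ht => by simpa using hψ t ht) (by simp) s t hs ht
  simpa using this

theorem aux_diff_s15 {E : Type*} [NormedAddCommGroup E] [InnerProductSpace ℂ E]
    [CompleteSpace E] (H μ : E →L[ℂ] E) (hH : IsSelfAdjoint H) (hμ : IsSelfAdjoint μ)
    (T d K : ℝ) (ε ε' : ℝ → ℝ) (ψ ψ' : ℝ → E)
    (hψ : ∀ t ∈ Set.Icc (0:ℝ) T,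
      HasDerivAt ψ ((-Complex.I) • (H - ε t • μ) (ψ t)) t)
    (hψ' : ∀ t ∈ Set.Icc (0:ℝ) T,
      HasDerivAt ψ' ((-Complex.I) • (H - ε' t • μ) (ψ' t)) t)
    (hd : ∀ t ∈ Set.Icc (0:ℝ) T, |ε t - ε' t| ≤ d)
    (hK : ∀ t ∈ Set.Icc (0:ℝ) T, ‖ψ' t‖ ≤ K)
    (s t : ℝ) (hs : s ∈ Set.Icc (0:ℝ) T) (ht : t ∈ Set.Icc (0:ℝ) T) :
    ‖ψ t - ψ' t‖ ≤ ‖ψ s - ψ' s‖ + d * (‖μ‖ * K) * |t - s| := by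
  refine aux_norm_growth (fun t => H - ε t • μ) (fun t => aux_selfadj H μ hH hμ _) T
    (d * (‖μ‖ * K)) (fun t => ψ t - ψ' t) (fun t => Complex.I • ((ε t - ε' t) • μ (ψ' t)))
    ?_ ?_ s t hs ht
  · intro r hr
    refine ((hψ r hr).sub (hψ' r hr)).congr_deriv ?_
    simp only [ContinuousLinearMap.sub_apply, ContinuousLinearMap.smul_apply, map_sub, sub_smul,
      smul_sub, neg_smul]
    abel
  · intro r hr
    have h1 := hd r hr
    have h2 := hK r hr
    have h0 : 0 ≤ d := (abs_nonneg _).trans h1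
    rw [norm_smul, norm_smul, Complex.norm_I, one_mul, Real.norm_eq_abs]
    have h3 : ‖μ (ψ' r)‖ ≤ ‖μ‖ * K := (μ.le_opNorm _).trans (by gcongr)
    gcongr

/-- Theorem 5 of the paper (uniqueness of critical points for large `α`): if two
bounded controls both satisfy the critical point equations of the cost functional
and `α > ‖O‖‖μ‖²T²(1 + e^{T‖μ‖M})e^{2T‖μ‖M}`, then the two controls coincide on
`[0,T]`. -/
theorem critical_point_unique_of_large_alpha
    {E : Type*} [NormedAddCommGroup E] [InnerProductSpace ℂ E] [CompleteSpace E]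
    (H μ O : E →L[ℂ] E) (hH : IsSelfAdjoint H) (hμ : IsSelfAdjoint μ)
    (hO : IsSelfAdjoint O)
    (T α M : ℝ) (hT : 1 ≤ T) (hα : 0 < α) (hM : 0 < M)
    (ε ε' : ℝ → ℝ)
    (hεc : ContinuousOn ε (Set.Icc 0 T)) (hε'c : ContinuousOn ε' (Set.Icc 0 T))
    (hεM : ∀ t ∈ Set.Icc (0:ℝ) T, |ε t| ≤ M)
    (hε'M : ∀ t ∈ Set.Icc (0:ℝ) T, |ε' t| ≤ M)
    (ψ₀ : E) (hψ₀ : ‖ψ₀‖ = 1)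
    (ψ ψ' χ χ' : ℝ → E)
    (hψ : ∀ t ∈ Set.Icc (0:ℝ) T,
      HasDerivAt ψ ((-Complex.I) • (H - ε t • μ) (ψ t)) t)
    (hψ0 : ψ 0 = ψ₀)
    (hψ' : ∀ t ∈ Set.Icc (0:ℝ) T,
      HasDerivAt ψ' ((-Complex.I) • (H - ε' t • μ) (ψ' t)) t)
    (hψ'0 : ψ' 0 = ψ₀)
    (hχ : ∀ t ∈ Set.Icc (0:ℝ) T,
      HasDerivAt χ ((-Complex.I) • (H - ε t • μ) (χ t)) t)
    (hχT : χ T = O (ψ T))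
    (hχ' : ∀ t ∈ Set.Icc (0:ℝ) T,
      HasDerivAt χ' ((-Complex.I) • (H - ε' t • μ) (χ' t)) t)
    (hχ'T : χ' T = O (ψ' T))
    (hcrit : ∀ t ∈ Set.Icc (0:ℝ) T,
      α * ε t = -(inner ℂ (χ t) (μ (ψ t)) : ℂ).im)
    (hcrit' : ∀ t ∈ Set.Icc (0:ℝ) T,
      α * ε' t = -(inner ℂ (χ' t) (μ (ψ' t)) : ℂ).im)
    (hbig : ‖O‖ * ‖μ‖ ^ 2 * T ^ 2 * (1 + Real.exp (T * ‖μ‖ * M)) *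
      Real.exp (2 * T * ‖μ‖ * M) < α) :
    ∀ t ∈ Set.Icc (0:ℝ) T, ε t = ε' t := by
  have hT0 : (0:ℝ) ≤ T := by linarith
  have m0 : (0:ℝ) ∈ Set.Icc (0:ℝ) T := ⟨le_rfl, hT0⟩
  have mT : T ∈ Set.Icc (0:ℝ) T := ⟨hT0, le_rfl⟩
  obtain ⟨t0, ht0, hmax⟩ := isCompact_Icc.exists_isMaxOn (s := Set.Icc (0:ℝ) T) ⟨0, m0⟩
    (f := fun t => |ε t - ε' t|) ((hεc.sub hε'c).abs)
  set d := |ε t0 - ε' t0| with hd_def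
  have hd : ∀ t ∈ Set.Icc (0:ℝ) T, |ε t - ε' t| ≤ d := fun t ht => hmax ht
  have hd0 : 0 ≤ d := abs_nonneg _
  have n1 : ∀ t ∈ Set.Icc (0:ℝ) T, ‖ψ t‖ ≤ 1 := fun t ht => by
    have := aux_norm_cons H μ hH hμ T ε ψ hψ 0 t m0 ht
    rwa [hψ0, hψ₀] at this
  have n2 : ∀ t ∈ Set.Icc (0:ℝ) T, ‖ψ' t‖ ≤ 1 := fun t ht => by
    have := aux_norm_cons H μ hH hμ T ε' ψ' hψ' 0 t m0 ht
    rwa [hψ'0, hψ₀] at this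
  have n3 : ∀ t ∈ Set.Icc (0:ℝ) T, ‖χ' t‖ ≤ ‖O‖ := fun t ht => by
    have h := aux_norm_cons H μ hH hμ T ε' χ' hχ' T t mT ht
    rw [hχ'T] at h
    have h2 := O.le_opNorm_of_le (n2 T mT)
    linarith
  have d1 : ∀ t ∈ Set.Icc (0:ℝ) T, ‖ψ t - ψ' t‖ ≤ d * ‖μ‖ * t := fun t ht => by
    have := aux_diff_s15 H μ hH hμ T d 1 ε ε' ψ ψ' hψ hψ' hd n2 0 t m0 ht
    simpa [hψ0, hψ'0, abs_of_nonneg ht.1] using this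
  have d2 : ∀ t ∈ Set.Icc (0:ℝ) T, ‖χ t - χ' t‖ ≤ ‖O‖ * (d * ‖μ‖ * (2 * T - t)) :=
    fun t ht => by
      have h := aux_diff_s15 H μ hH hμ T d ‖O‖ ε ε' χ χ' hχ hχ' hd n3 T t mT ht
      rw [hχT, hχ'T, ← map_sub, abs_of_nonpos (by linarith [ht.2])] at h
      have h2 := O.le_opNorm_of_le (d1 T mT)
      nlinarith
  have main : α * d ≤ 2 * (‖O‖ * ‖μ‖ ^ 2 * T) * d := by
    have e1 : α * (ε t0 - ε' t0) = -(inner ℂ (χ t0 - χ' t0) (μ (ψ t0))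
        + inner ℂ (χ' t0) (μ (ψ t0 - ψ' t0)) : ℂ).im := by
      rw [mul_sub, hcrit t0 ht0, hcrit' t0 ht0, map_sub, inner_sub_left, inner_sub_right]
      simp only [Complex.add_im, Complex.sub_im]
      ring
    have e2 : α * d = |α * (ε t0 - ε' t0)| := by rw [abs_mul, abs_of_pos hα]
    rw [e2, e1, abs_neg]
    have b1 : ‖μ (ψ t0)‖ ≤ ‖μ‖ * 1 := μ.le_opNorm_of_le (n1 t0 ht0)
    have b2 := μ.le_opNorm_of_le (d1 t0 ht0)
    have hx := ht0.1
    have hy := ht0.2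
    calc _ ≤ ‖(inner ℂ (χ t0 - χ' t0) (μ (ψ t0))
        + inner ℂ (χ' t0) (μ (ψ t0 - ψ' t0)) : ℂ)‖ := Complex.abs_im_le_norm _
      _ ≤ ‖χ t0 - χ' t0‖ * ‖μ (ψ t0)‖ + ‖χ' t0‖ * ‖μ (ψ t0 - ψ' t0)‖ :=
        (norm_add_le _ _).trans (add_le_add (norm_inner_le_norm _ _) (norm_inner_le_norm _ _))
      _ ≤ (‖O‖ * (d * ‖μ‖ * (2 * T - t0))) * (‖μ‖ * 1) + ‖O‖ * (‖μ‖ * (d * ‖μ‖ * t0)) := by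
        have hz : 0 ≤ 2 * T - t0 := by linarith
        exact add_le_add
          (mul_le_mul (d2 t0 ht0) b1 (norm_nonneg _) (by positivity))
          (mul_le_mul (n3 t0 ht0) b2 (norm_nonneg _) (norm_nonneg _))
      _ = _ := by ring
  have big : 2 * (‖O‖ * ‖μ‖ ^ 2 * T) < α := by
    refine lt_of_le_of_lt ?_ hbig
    have x1 : 1 ≤ Real.exp (T * ‖μ‖ * M) := Real.one_le_exp (by positivity)
    have x2 : 1 ≤ Real.exp (2 * T * ‖μ‖ * M) := Real.one_le_exp (by positivity)
    have x3 : T ≤ T ^ 2 := by nlinarith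
    calc 2 * (‖O‖ * ‖μ‖ ^ 2 * T) = ‖O‖ * ‖μ‖ ^ 2 * T * (1 + 1) * 1 := by ring
      _ ≤ _ := by gcongr
  have hdz : d = 0 := by
    by_contra hne
    have : 0 < d := lt_of_le_of_ne hd0 (Ne.symm hne)
    nlinarith
  intro t ht
  have := hd t ht
  rw [hdz] at this
  exact sub_eq_zero.1 (abs_nonpos_iff.1 this)
end

section
/- The sequence (u_n)_{n∈ℕ} defined by u_n = sin(log(n+1)) does not converge: there is no real number L such that u_n → L as n → ∞. -/
open Filter

lemma sin_log_aux (L : ℝ)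
    (h : Tendsto (fun n : ℕ => Real.sin (Real.log (n + 1))) atTop (nhds L)) (c : ℝ) :
    L = Real.sin c := by
  have ht : Tendsto (fun k : ℕ => c + (k : ℝ) * (2 * Real.pi)) atTop atTop :=
    tendsto_atTop_add_const_left _ _
      (tendsto_natCast_atTop_atTop.atTop_mul_const (by positivity))
  have hn : Tendsto (fun k : ℕ => ⌊Real.exp (c + (k : ℝ) * (2 * Real.pi))⌋₊) atTop atTop :=
    tendsto_nat_floor_atTop.comp (Real.tendsto_exp_atTop.comp ht)
  have h1 := h.comp hn
  have he : Tendsto (fun k : ℕ => c + Real.exp (-(c + (k : ℝ) * (2 * Real.pi)))) atTop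
      (nhds c) := by
    have := (Real.tendsto_exp_neg_atTop_nhds_zero.comp ht).const_add c
    simpa using this
  have hd : Tendsto (fun k : ℕ => Real.log ((⌊Real.exp (c + (k : ℝ) * (2 * Real.pi))⌋₊ : ℝ) + 1)
      - (k : ℝ) * (2 * Real.pi)) atTop (nhds c) := by
    refine tendsto_of_tendsto_of_tendsto_of_le_of_le tendsto_const_nhds he ?_ ?_
    · intro k
      have h2 := Nat.lt_floor_add_one (Real.exp (c + (k : ℝ) * (2 * Real.pi)))
      have h3 := (Real.le_log_iff_exp_le (by positivity)).2 h2.le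
      show c ≤ _
      linarith
    · intro k
      show Real.log _ - _ ≤ c + Real.exp _
      generalize hT : c + (k : ℝ) * (2 * Real.pi) = t
      have h2 := Nat.floor_le (Real.exp_pos t).le
      have h3 : Real.log ((⌊Real.exp t⌋₊ : ℝ) + 1) ≤ t + Real.exp (-t) := by
        rw [Real.log_le_iff_le_exp (by positivity), Real.exp_add]
        have h4 := Real.add_one_le_exp (Real.exp (-t))
        have h5 : Real.exp t * Real.exp (-t) = 1 := by rw [← Real.exp_add]; simp
        nlinarith [Real.exp_pos t]
      linarith
  have h6 := (Real.continuous_sin.tendsto c).comp hd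
  refine tendsto_nhds_unique h1 (h6.congr fun k => ?_)
  exact Real.sin_sub_nat_mul_two_pi _ k

/-- The sequence `u_n = sin(log(n+1))` does not converge. -/
theorem not_tendsto_sin_log :
    ¬ ∃ L : ℝ, Tendsto (fun n : ℕ => Real.sin (Real.log (n + 1))) atTop (nhds L) := by
  rintro ⟨L, h⟩
  have h0 := sin_log_aux L h 0
  have h1 := sin_log_aux L h (Real.pi / 2)
  rw [Real.sin_zero] at h0
  rw [Real.sin_pi_div_two] at h1
  linarith
end
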